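/- arXiv:2002.07463 — 6 statements merged into one kernel-verified Lean document; each statement's English description precedes it below -/
import Mathlib

section
/- Let V be a finite set of points in a metric space, M = (V, I) a matroid on V, z a nonnegative integer, and ε' ∈ (0,1). Let X* ∈ I be a solution of the robust matroid center instance (M, z) of cost r*, i.e., there exists W ⊆ V with |W| ≥ |V| − z and d(j, X*) ≤ r* for all j ∈ W. Let T ⊆ V be a coreset with proxy function p : V → T, and for i ∈ T let m_i = |{j ∈ V : p(j) = i}|. Assume (C1) d(j, p(j)) ≤ ε'·r* for every j ∈ V, and (C2) there exists an injective map π : X* → T such that {π(o) : o ∈ X*} ∈ I and d(o, π(o)) ≤ ε'·r* for every o ∈ X*. Then there exists an independent set Y ⊆ T (Y ∈ I) and a set X ⊆ T with Σ_{i ∈ X} m_i ≥ |V| − z and d(i, Y) ≤ (1 + 2ε')·r* for every i ∈ X. -/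
/-- **Property P1 of the coreset (Lemma 3, first part).**
Let `V` be a finite set of points in a metric space, `M = (V, I)` a matroid on `V`,
`z ≥ 0`, `ε' ∈ (0,1)`. Let `Xstar ∈ I` be a solution of the robust matroid center
instance `(M, z)` of cost `rstar`: there is `W ⊆ V` with `|W| ≥ |V| − z` and
`d(j, Xstar) ≤ rstar` for all `j ∈ W`. Let `T ⊆ V` be a coreset with proxy function
`p : V → T` and multiplicities `m i = |{j ∈ V : p j = i}|`. Assume
(C1) `d(j, p j) ≤ ε'·rstar` for all `j ∈ V`, and
(C2) there is an injective map `π : Xstar → T` whose image is independent with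
`d(o, π o) ≤ ε'·rstar` for all `o ∈ Xstar`. Then there is an independent `Y ⊆ T` and
a set `X ⊆ T` with `Σ_{i ∈ X} m i ≥ |V| − z` and `d(i, Y) ≤ (1 + 2ε')·rstar` for
every `i ∈ X`. -/
theorem coreset_property_P1 {α : Type*} [MetricSpace α] [DecidableEq α]
    (V : Finset α) (I : Finset α → Prop)
    (hground : ∀ A : Finset α, I A → A ⊆ V)
    (hempty : I ∅)
    (hhered : ∀ A B : Finset α, B ⊆ A → I A → I B)
    (haug : ∀ A B : Finset α, I A → I B → B.card < A.card →
      ∃ x ∈ A \ B, I (insert x B))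
    (z : ℕ) (ε' : ℝ) (hε' : ε' ∈ Set.Ioo (0 : ℝ) 1)
    (rstar : ℝ)
    (Xstar : Finset α) (hXstar : I Xstar)
    (W : Finset α) (hW : W ⊆ V) (hWcard : V.card - z ≤ W.card)
    (hWcov : ∀ j ∈ W, ∃ c ∈ Xstar, dist j c ≤ rstar)
    (T : Finset α) (hT : T ⊆ V)
    (p : α → α) (hp : ∀ j ∈ V, p j ∈ T)
    (hC1 : ∀ j ∈ V, dist j (p j) ≤ ε' * rstar)
    (π : α → α) (hπinj : Set.InjOn π Xstar)
    (hπT : ∀ o ∈ Xstar, π o ∈ T)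
    (hπind : I (Xstar.image π))
    (hπdist : ∀ o ∈ Xstar, dist o (π o) ≤ ε' * rstar) :
    ∃ Y X : Finset α, Y ⊆ T ∧ I Y ∧ X ⊆ T ∧
      V.card - z ≤ ∑ i ∈ X, (V.filter (fun j => p j = i)).card ∧
      ∀ i ∈ X, ∃ c ∈ Y, dist i c ≤ (1 + 2 * ε') * rstar := by
  refine ⟨Xstar.image π, W.image p, Finset.image_subset_iff.2 hπT, hπind,
    Finset.image_subset_iff.2 fun j hj => hp j (hW hj), ?_, ?_⟩
  · calc V.card - z ≤ W.card := hWcard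
      _ = ∑ i ∈ W.image p, (W.filter (fun j => p j = i)).card :=
        Finset.card_eq_sum_card_image p W
      _ ≤ ∑ i ∈ W.image p, (V.filter (fun j => p j = i)).card :=
        Finset.sum_le_sum fun i _ => Finset.card_le_card (Finset.filter_subset_filter _ hW)
  · intro i hi
    obtain ⟨j, hj, rfl⟩ := Finset.mem_image.1 hi
    obtain ⟨c, hc, hjc⟩ := hWcov j hj
    refine ⟨π c, Finset.mem_image_of_mem π hc, ?_⟩
    have hpj := hC1 j (hW hj)
    rw [dist_comm] at hpj
    linarith [dist_triangle4 (p j) j c (π c), hπdist c hc]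
end

section
/- Let M = (V, I) be a matroid on a finite ground set V, let C₁, C₂, …, C_τ be a partition of V, and for each ℓ let Y_ℓ be a maximal independent subset of C_ℓ (i.e., Y_ℓ ⊆ C_ℓ, Y_ℓ ∈ I, and no independent subset of C_ℓ has larger cardinality). Then for every independent set X ∈ I there exists an injective map π : X → ∪_{ℓ} Y_ℓ such that {π(j) : j ∈ X} ∈ I and, for every ℓ and every j ∈ X ∩ C_ℓ, π(j) ∈ Y_ℓ. -/
/-- If `Y` is a maximum independent subset of `C`, and adding some `j ∈ C` to `A` gives a larger
independent set, then `j` can be replaced by an element of `Y`. -/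
theorem exists_insert_indep_of_mem {α : Type*} [DecidableEq α] {I : Finset α → Prop}
    (hhered : ∀ A B : Finset α, B ⊆ A → I A → I B)
    (haug : ∀ A B : Finset α, I A → I B → B.card < A.card → ∃ x ∈ A \ B, I (insert x B))
    {C Y A : Finset α} {j : α} (hYsub : Y ⊆ C) (hY : I Y)
    (hYmax : ∀ B : Finset α, B ⊆ C → I B → B.card ≤ Y.card)
    (hjC : j ∈ C) (hjA : j ∉ A) (hA : I (insert j A)) :
    ∃ y ∈ Y, y ∉ A ∧ I (insert y A) := by
  classical
  by_contra! hno
  obtain ⟨Z, hZ, hZmax⟩ := Finset.exists_max_image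
    ((Y ∪ A).powerset.filter fun Z => Y ⊆ Z ∧ I Z) Finset.card
    ⟨Y, Finset.mem_filter.mpr
      ⟨Finset.mem_powerset.mpr Finset.subset_union_left, subset_rfl, hY⟩⟩
  simp only [Finset.mem_filter, Finset.mem_powerset] at hZ hZmax
  obtain ⟨hZsub, hYZ, hZI⟩ := hZ
  have hZcard : Z.card ≤ A.card := by
    by_contra! hlt
    obtain ⟨x, hx, hxI⟩ := haug Z A hZI (hhered _ _ (Finset.subset_insert j A) hA) hlt
    obtain ⟨hxZ, hxA⟩ := Finset.mem_sdiff.mp hx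
    exact hno x ((Finset.mem_union.mp (hZsub hxZ)).resolve_right hxA) hxA hxI
  obtain ⟨x, hx, hxI⟩ := haug (insert j A) Z hA hZI
    (by rw [Finset.card_insert_of_notMem hjA]; omega)
  obtain ⟨hxA, hxZ⟩ := Finset.mem_sdiff.mp hx
  rcases Finset.mem_insert.mp hxA with rfl | hxA
  · have h := hYmax (insert x Y) (Finset.insert_subset hjC hYsub)
      (hhered _ _ (Finset.insert_subset_insert x hYZ) hxI)
    rw [Finset.card_insert_of_notMem fun h => hxZ (hYZ h)] at h
    omega
  · have h := hZmax (insert x Z)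
      ⟨Finset.insert_subset (Finset.mem_union_right Y hxA) hZsub,
        hYZ.trans (Finset.subset_insert x Z), hxI⟩
    rw [Finset.card_insert_of_notMem hxZ] at h
    omega

/-- Let `M = (V, I)` be a matroid on a finite ground set `V`, let `C₁, …, C_τ` be a
partition of `V`, and for each `ℓ` let `Y ℓ` be a maximal independent subset of
`C ℓ`. Then for every independent set `X ∈ I` there exists an injective map
`π : X → ∪_ℓ Y ℓ` such that the image of `X` under `π` is independent and, for every
`ℓ` and every `j ∈ X ∩ C ℓ`, `π j ∈ Y ℓ`. -/
theorem matroid_partition_mapping {α : Type*} [DecidableEq α]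
    (V : Finset α) (I : Finset α → Prop)
    (hground : ∀ A : Finset α, I A → A ⊆ V)
    (hempty : I ∅)
    (hhered : ∀ A B : Finset α, B ⊆ A → I A → I B)
    (haug : ∀ A B : Finset α, I A → I B → B.card < A.card →
      ∃ x ∈ A \ B, I (insert x B))
    (τ : ℕ) (C : Fin τ → Finset α)
    (hdisj : ∀ ℓ ℓ' : Fin τ, ℓ ≠ ℓ' → Disjoint (C ℓ) (C ℓ'))
    (hcover : Finset.univ.biUnion C = V)
    (Y : Fin τ → Finset α)
    (hYsub : ∀ ℓ, Y ℓ ⊆ C ℓ)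
    (hYind : ∀ ℓ, I (Y ℓ))
    (hYmax : ∀ ℓ, ∀ B : Finset α, B ⊆ C ℓ → I B → B.card ≤ (Y ℓ).card)
    (X : Finset α) (hX : I X) :
    ∃ π : α → α, Set.InjOn π ↑X ∧ I (X.image π) ∧
      (∀ j ∈ X, π j ∈ Finset.univ.biUnion Y) ∧
      ∀ ℓ : Fin τ, ∀ j ∈ X ∩ C ℓ, π j ∈ Y ℓ := by
  have key : ∀ S : Finset α, S ⊆ X → ∃ π : α → α, Set.InjOn π ↑X ∧ I (X.image π) ∧
      (∀ j ∉ S, π j = j) ∧ ∀ j ∈ S, ∀ ℓ, j ∈ C ℓ → π j ∈ Y ℓ := by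
    intro S
    induction S using Finset.induction_on with
    | empty => exact fun _ => ⟨id, Set.injOn_id _, by simpa using hX, by simp, by simp⟩
    | insert j S hjS ih =>
      intro hS
      obtain ⟨hjX, hSX⟩ := Finset.insert_subset_iff.mp hS
      obtain ⟨π, hinj, hπI, hfix, hπY⟩ := ih hSX
      obtain ⟨ℓ, -, hjC⟩ := Finset.mem_biUnion.mp (hcover.symm ▸ hground X hX hjX)
      have hjA : j ∉ (X.erase j).image π := by
        intro h
        obtain ⟨i, hi, hij⟩ := Finset.mem_image.mp h
        obtain ⟨hne, hiX⟩ := Finset.mem_erase.mp hi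
        exact hne (hinj hiX hjX (hij.trans (hfix j hjS).symm))
      have hins : insert j ((X.erase j).image π) = X.image π := by
        conv_rhs => rw [← Finset.insert_erase hjX, Finset.image_insert, hfix j hjS]
      obtain ⟨y, hyY, hyA, hyI⟩ := exists_insert_indep_of_mem hhered haug (hYsub ℓ) (hYind ℓ)
        (hYmax ℓ) hjC hjA (hins.symm ▸ hπI)
      have hne : ∀ i ∈ X, i ≠ j → π i ≠ y := fun i hi hij h =>
        hyA (Finset.mem_image.mpr ⟨i, Finset.mem_erase.mpr ⟨hij, hi⟩, h⟩)
      refine ⟨Function.update π j y, ?_, ?_, ?_, ?_⟩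
      · intro a ha b hb hab
        by_cases haj : a = j <;> by_cases hbj : b = j
        · rw [haj, hbj]
        · subst haj
          rw [Function.update_self, Function.update_of_ne hbj] at hab
          exact (hne b hb hbj hab.symm).elim
        · subst hbj
          rw [Function.update_self, Function.update_of_ne haj] at hab
          exact (hne a ha haj hab).elim
        · rw [Function.update_of_ne haj, Function.update_of_ne hbj] at hab
          exact hinj ha hb hab
      · have himage : X.image (Function.update π j y) = insert y ((X.erase j).image π) := by
          conv_lhs => rw [← Finset.insert_erase hjX, Finset.image_insert, Function.update_self]
          congr 1
          exact Finset.image_congr fun i hi =>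
            Function.update_of_ne (Finset.ne_of_mem_erase hi) _ _
        rwa [himage]
      · intro i hi
        rw [Finset.mem_insert, not_or] at hi
        rw [Function.update_of_ne hi.1, hfix i hi.2]
      · intro i hi m him
        by_cases hij : i = j
        · subst hij
          rw [Function.update_self]
          obtain rfl : ℓ = m := by
            by_contra h
            exact Finset.disjoint_left.mp (hdisj ℓ m h) hjC him
          exact hyY
        · rw [Function.update_of_ne hij]
          exact hπY i (Finset.mem_of_mem_insert_of_ne hi hij) m him
  obtain ⟨π, hinj, hπI, -, hπY⟩ := key X subset_rfl
  refine ⟨π, hinj, hπI, fun j hj => ?_, fun ℓ j hj => ?_⟩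
  · obtain ⟨ℓ, -, hjC⟩ := Finset.mem_biUnion.mp (hcover.symm ▸ hground X hX hj)
    exact Finset.mem_biUnion.mpr ⟨ℓ, Finset.mem_univ ℓ, hπY j hj ℓ hjC⟩
  · exact hπY j (Finset.mem_inter.mp hj).1 ℓ (Finset.mem_inter.mp hj).2
end

section
/- Let V be a finite set of points in a metric space, M = (V, I) a matroid of rank k on V, z a nonnegative integer, β ≥ 1, and ε' ∈ (0,1). Let X* ∈ I be an optimal solution of the robust matroid center instance (M, z) with cost r* (so |X*| ≤ k, there exists W ⊆ V with |W| ≥ |V| − z and d(j, X*) ≤ r* for all j ∈ W). Let T_{k+z} ⊆ V with |T_{k+z}| = k + z be a β-approximate solution to (k+z)-center on V, i.e., r_{T_{k+z}} := max_{j ∈ V} d(j, T_{k+z}) ≤ β · max_{j ∈ V} d(j, S'') for every S'' ⊆ V with |S''| ≤ k + z. Let T_τ ⊆ V satisfy max_{j ∈ V} d(j, T_τ) ≤ (ε'/(2β))·r_{T_{k+z}}, let C₁, …, C_τ be the clusters of V obtained by assigning each point of V to (one of) its closest points of T_τ, let Y_ℓ be a maximal independent subset of C_ℓ for each ℓ,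 let T = ∪_ℓ Y_ℓ, and for j ∈ C_ℓ define p(j) to be a point of Y_ℓ closest to j. Then: (C1) d(j, p(j)) ≤ ε'·r* for every j ∈ V; and (C2) for every independent set X ∈ I there exists an injective map π : X → T such that {π(j) : j ∈ X} ∈ I and d(j, π(j)) ≤ ε'·r* for every j ∈ X. -/
/-- An independent set `A` extends, by elements of an independent set `B`, to an independent set
at least as large as `B`. -/
theorem exists_indep_extension {α : Type*} [DecidableEq α] {I : Finset α → Prop}
    (haug : ∀ A B : Finset α, I A → I B → B.card < A.card → ∃ x ∈ A \ B, I (insert x B))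
    {B : Finset α} (hB : I B) {A : Finset α} (hA : I A) :
    ∃ A' : Finset α, A ⊆ A' ∧ A' ⊆ A ∪ B ∧ I A' ∧ B.card ≤ A'.card := by
  induction hn : B.card - A.card generalizing A with
  | zero => exact ⟨A, subset_rfl, Finset.subset_union_left, hA, by omega⟩
  | succ n ih =>
    obtain ⟨x, hx, hxA⟩ := haug B A hB hA (by omega)
    rw [Finset.mem_sdiff] at hx
    have hcard := Finset.card_insert_of_notMem hx.2
    obtain ⟨A', hAA', hA'B, hA', hle⟩ := ih hxA (by omega)
    refine ⟨A', (Finset.subset_insert x A).trans hAA', hA'B.trans ?_, hA', hle⟩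
    intro w hw
    simp only [Finset.mem_union, Finset.mem_insert] at hw ⊢
    rcases hw with (rfl | hw) | hw
    · exact Or.inr hx.1
    · exact Or.inl hw
    · exact Or.inr hw

/-- If `x ∈ X` depends on the independent set `Y`, then `x` can be exchanged for some element
of `Y` outside `X.erase x`, keeping `X` independent. -/
theorem exists_indep_exchange {α : Type*} [DecidableEq α] {I : Finset α → Prop}
    (hhered : ∀ A B : Finset α, B ⊆ A → I A → I B)
    (haug : ∀ A B : Finset α, I A → I B → B.card < A.card → ∃ x ∈ A \ B, I (insert x B))
    {X Y : Finset α} (hX : I X) (hY : I Y) {x : α} (hx : x ∈ X) (hdep : ¬ I (insert x Y)) :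
    ∃ y ∈ Y, y ∉ X.erase x ∧ I (insert y (X.erase x)) := by
  obtain ⟨A, hYA, hAX, hA, hle⟩ := exists_indep_extension haug hX hY
  have hxA : x ∉ A := fun h => hdep (hhered A _ (Finset.insert_subset h hYA) hA)
  obtain ⟨y, hy, hyI⟩ := haug A (X.erase x) hA (hhered X _ (Finset.erase_subset x X) hX)
    ((Finset.card_erase_lt_of_mem hx).trans_le hle)
  rw [Finset.mem_sdiff] at hy
  refine ⟨y, ?_, hy.2, hyI⟩
  rcases Finset.mem_union.1 (hAX hy.1) with h | h
  · exact h
  · have hyx : y ≠ x := fun e => hxA (e ▸ hy.1)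
    exact absurd (Finset.mem_erase.2 ⟨hyx, h⟩) hy.2

/-- Suppose every point of the ground set outside `T` depends on an independent subset of `T`
contained in its own fibre of `a`. Then every independent set can be mapped injectively into `T`,
along the fibres of `a`, with independent image. -/
theorem exists_injOn_indep_image {α : Type*} [DecidableEq α] {I : Finset α → Prop}
    (hhered : ∀ A B : Finset α, B ⊆ A → I A → I B)
    (haug : ∀ A B : Finset α, I A → I B → B.card < A.card → ∃ x ∈ A \ B, I (insert x B))
    {T : Finset α} {a : α → α}
    (hspan : ∀ x ∉ T, I {x} → ∃ Y ⊆ T, I Y ∧ (∀ y ∈ Y, a y = a x) ∧ ¬ I (insert x Y))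
    {X : Finset α} (hX : I X) :
    ∃ π : α → α, Set.InjOn π ↑X ∧ I (X.image π) ∧ ∀ j ∈ X, π j ∈ T ∧ a (π j) = a j := by
  induction hn : (X \ T).card generalizing X with
  | zero =>
    rw [Finset.card_eq_zero, Finset.sdiff_eq_empty_iff_subset] at hn
    exact ⟨id, Set.injOn_id _, by simpa using hX, fun j hj => ⟨hn hj, rfl⟩⟩
  | succ n ih =>
    obtain ⟨x, hx⟩ : (X \ T).Nonempty := Finset.card_pos.1 (by omega)
    obtain ⟨hxX, hxT⟩ := Finset.mem_sdiff.1 hx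
    obtain ⟨Y, hYT, hY, hYa, hdep⟩ :=
      hspan x hxT (hhered X _ (Finset.singleton_subset_iff.2 hxX) hX)
    obtain ⟨y, hyY, hyX, hyI⟩ := exists_indep_exchange hhered haug hX hY hxX hdep
    have hdiff : insert y (X.erase x) \ T = (X \ T).erase x := by
      rw [Finset.insert_sdiff_of_mem _ (hYT hyY), Finset.erase_sdiff_comm]
    obtain ⟨π, hinj, hI, hπ⟩ := ih hyI (by rw [hdiff, Finset.card_erase_of_mem hx]; omega)
    have hf : ∀ j ∈ X, Function.update id x y j ∈ insert y (X.erase x) := by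
      intro j hj
      by_cases h : j = x
      · subst h; simp
      · simp [h, hj]
    have hfinj : Set.InjOn (Function.update id x y) (X : Set α) := by
      intro i hi j hj hij
      have hi' : i ∈ X := hi
      have hj' : j ∈ X := hj
      simp only [Function.update_apply, id] at hij
      rw [Finset.mem_erase] at hyX
      split_ifs at hij <;> grind
    refine ⟨π ∘ Function.update id x y, hinj.comp hfinj fun j hj => hf j hj,
      hhered _ _ ?_ hI, fun j hj => ?_⟩
    · intro w hw
      obtain ⟨j, hj, rfl⟩ := Finset.mem_image.1 hw
      exact Finset.mem_image_of_mem π (hf j hj)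
    · refine ⟨(hπ _ (hf j hj)).1, (hπ _ (hf j hj)).2.trans ?_⟩
      by_cases h : j = x
      · subst h; simpa using hYa y hyY
      · simp [h]

/-- **The RMC coreset construction satisfies C1 and C2 (Lemma 4).**
Let `V` be a finite set of points in a metric space, `M = (V, I)` a matroid of rank
`k` on `V`, `z ≥ 0`, `β ≥ 1`, `ε' ∈ (0,1)`. Let `Xstar ∈ I` be an optimal solution
of the robust matroid center instance `(M, z)` with cost `rstar` (`|Xstar| ≤ k`,
there is `W ⊆ V` with `|W| ≥ |V| − z` and `d(j, Xstar) ≤ rstar` for all `j ∈ W`).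
Let `Tkz ⊆ V` with `|Tkz| = k + z` be a `β`-approximate solution to `(k+z)`-center
on `V` with radius `r0`: every point of `V` is within `r0` of `Tkz` and
`r0 ≤ β · r''` for every covering radius `r''` achieved by any `S'' ⊆ V` with
`|S''| ≤ k + z`. Let `Tτ ⊆ V` be such that every point `j` of `V` is assigned (via
`a`) to a closest point of `Tτ`, at distance at most `(ε'/(2β))·r0`; the clusters are
the fibers of `a`. For each `i ∈ Tτ` let `Y i` be a maximal independent subset of the
cluster of `i`, let `T = ∪_{i ∈ Tτ} Y i`, and for `j ∈ V` let `p j` be a point of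
`Y (a j)` closest to `j`. Then:
(C1) `d(j, p j) ≤ ε'·rstar` for every `j ∈ V`; and
(C2) for every independent `X ∈ I` there exists an injective `π : X → T` with
independent image such that `d(j, π j) ≤ ε'·rstar` for every `j ∈ X`. -/
theorem rmc_coreset_satisfies_C1_C2 {α : Type*} [MetricSpace α] [DecidableEq α]
    (V : Finset α) (I : Finset α → Prop)
    (hground : ∀ A : Finset α, I A → A ⊆ V)
    (hempty : I ∅)
    (hhered : ∀ A B : Finset α, B ⊆ A → I A → I B)
    (haug : ∀ A B : Finset α, I A → I B → B.card < A.card →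
      ∃ x ∈ A \ B, I (insert x B))
    (k z : ℕ) (β ε' : ℝ) (hβ : 1 ≤ β) (hε' : ε' ∈ Set.Ioo (0 : ℝ) 1)
    (rstar : ℝ) (hrstar : 0 ≤ rstar)
    (Xstar : Finset α) (hXstar : I Xstar) (hXstarcard : Xstar.card ≤ k)
    (W : Finset α) (hW : W ⊆ V) (hWcard : V.card - z ≤ W.card)
    (hWcov : ∀ j ∈ W, ∃ c ∈ Xstar, dist j c ≤ rstar)
    (Tkz : Finset α) (hTkz : Tkz ⊆ V) (hTkzcard : Tkz.card = k + z)
    (r0 : ℝ) (hr0 : ∀ j ∈ V, ∃ c ∈ Tkz, dist j c ≤ r0)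
    (happrox : ∀ S'' : Finset α, S'' ⊆ V → S''.card ≤ k + z →
      ∀ r'' : ℝ, (∀ j ∈ V, ∃ c ∈ S'', dist j c ≤ r'') → r0 ≤ β * r'')
    (Tτ : Finset α) (hTτ : Tτ ⊆ V)
    (a : α → α) (ha : ∀ j ∈ V, a j ∈ Tτ)
    (haclose : ∀ j ∈ V, ∀ c ∈ Tτ, dist j (a j) ≤ dist j c)
    (hTτcov : ∀ j ∈ V, dist j (a j) ≤ (ε' / (2 * β)) * r0)
    (Y : α → Finset α)
    (hYsub : ∀ i ∈ Tτ, Y i ⊆ V.filter (fun j => a j = i))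
    (hYind : ∀ i ∈ Tτ, I (Y i))
    (hYmax : ∀ i ∈ Tτ, ∀ B : Finset α,
      B ⊆ V.filter (fun j => a j = i) → I B → B.card ≤ (Y i).card)
    (T : Finset α) (hTdef : T = Tτ.biUnion Y)
    (p : α → α) (hpY : ∀ j ∈ V, p j ∈ Y (a j))
    (hpclose : ∀ j ∈ V, ∀ y ∈ Y (a j), dist j (p j) ≤ dist j y) :
    (∀ j ∈ V, dist j (p j) ≤ ε' * rstar) ∧
    (∀ X : Finset α, I X →
      ∃ π : α → α, Set.InjOn π ↑X ∧ I (X.image π) ∧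
        (∀ j ∈ X, π j ∈ T) ∧ ∀ j ∈ X, dist j (π j) ≤ ε' * rstar) := by
  have hβ0 : 0 < β := by linarith
  have hr0le : r0 ≤ β * rstar := by
    refine happrox (Xstar ∪ V \ W)
      (Finset.union_subset (hground _ hXstar) Finset.sdiff_subset) ?_ rstar fun j hj => ?_
    · have h1 := Finset.card_union_le Xstar (V \ W)
      have h2 := Finset.card_sdiff_of_subset hW
      omega
    · by_cases hjW : j ∈ W
      · obtain ⟨c, hc, hjc⟩ := hWcov j hjW
        exact ⟨c, Finset.mem_union_left _ hc, hjc⟩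
      · exact ⟨j, Finset.mem_union_right _ (Finset.mem_sdiff.2 ⟨hj, hjW⟩), by simpa using hrstar⟩
  have hhalf : ∀ j ∈ V, dist j (a j) ≤ ε' * rstar / 2 := by
    intro j hj
    have hcoef : 0 ≤ ε' / (2 * β) := div_nonneg hε'.1.le (by linarith)
    calc dist j (a j) ≤ ε' / (2 * β) * r0 := hTτcov j hj
      _ ≤ ε' / (2 * β) * (β * rstar) := mul_le_mul_of_nonneg_left hr0le hcoef
      _ = ε' * rstar / 2 := by field_simp
  have hclose : ∀ i ∈ V, ∀ j ∈ V, a j = a i → dist i j ≤ ε' * rstar := by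
    intro i hi j hj hij
    have h1 := hhalf i hi
    have h2 := hhalf j hj
    have h3 := dist_triangle_right i j (a i)
    rw [hij] at h2
    linarith
  have hYmem : ∀ i ∈ Tτ, ∀ y ∈ Y i, y ∈ V ∧ a y = i := fun i hi y hy =>
    Finset.mem_filter.1 (hYsub i hi hy)
  refine ⟨fun j hj => ?_, fun X hX => ?_⟩
  · obtain ⟨hpV, hpa⟩ := hYmem _ (ha j hj) _ (hpY j hj)
    exact hclose j hj _ hpV hpa
  · have hspan : ∀ x ∉ T, I {x} →
        ∃ Z ⊆ T, I Z ∧ (∀ y ∈ Z, a y = a x) ∧ ¬ I (insert x Z) := by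
      intro x hxT hx
      have hxV : x ∈ V := hground _ hx (Finset.mem_singleton_self x)
      have hax := ha x hxV
      have hsub : Y (a x) ⊆ T := hTdef ▸ Finset.subset_biUnion_of_mem Y hax
      refine ⟨Y (a x), hsub, hYind _ hax, fun y hy => (hYmem _ hax y hy).2, fun hI => ?_⟩
      have hle := hYmax _ hax _
        (Finset.insert_subset (Finset.mem_filter.2 ⟨hxV, rfl⟩) (hYsub _ hax)) hI
      rw [Finset.card_insert_of_notMem fun h => hxT (hsub h)] at hle
      omega
    obtain ⟨π, hinj, hI, hπ⟩ := exists_injOn_indep_image hhered haug hspan hX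
    exact ⟨π, hinj, hI, fun j hj => (hπ j hj).1, fun j hj =>
      hclose j (hground _ hX hj) _ (hground _ hI (Finset.mem_image_of_mem π hj)) (hπ j hj).2⟩
end

section
/- Let V be a finite set of points in a metric space, M = (V, I) a matroid on V, z a nonnegative integer, ε ∈ (0,1), α ≥ 1, and set ε' = ε/(2α+1). Let r* ≥ 0, let T ⊆ V be a coreset with proxy function p : V → T satisfying d(j, p(j)) ≤ ε'·r* for every j ∈ V, and for i ∈ T let m_i = |{j ∈ V : p(j) = i}|. For an independent set Y ⊆ T, define its coreset cost as the least r such that there exists X ⊆ T with Σ_{i ∈ X} m_i ≥ |V| − z and d(i, Y) ≤ r for all i ∈ X. Assume (P1) there exists an independent set Y₀ ⊆ T whose coreset cost is at most (1 + 2ε')·r*. Let S ⊆ T be an independent set that is an α-approximate solution to the coreset instance, i.e., the coreset cost r_S of S satisfies r_S ≤ α · (coreset cost of Y) for every independent set Y ⊆ T. Then there exists W ⊆ V with |W| ≥ |V| − z and d(j, S) ≤ (α + ε)·r* for every j ∈ W. -/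
/-- **Theorem 7: from an `α`-approximate solution on the coreset to an
`(α + ε)`-approximate solution on `V`.**
Let `V` be a finite set of points in a metric space, `M = (V, I)` a matroid on `V`,
`z ≥ 0`, `ε ∈ (0,1)`, `α ≥ 1`, and set `ε' = ε/(2α+1)`. Let `rstar ≥ 0`, let `T ⊆ V`
be a coreset with proxy function `p : V → T` satisfying `d(j, p j) ≤ ε'·rstar` for
all `j ∈ V`, with multiplicities `m i = |{j ∈ V : p j = i}|`. The coreset cost of an
independent `Y ⊆ T` is the least `r` such that some `X ⊆ T` with
`Σ_{i ∈ X} m i ≥ |V| − z` has `d(i, Y) ≤ r` for all `i ∈ X`. Assume (P1) some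
independent `Y₀ ⊆ T` has coreset cost at most `(1 + 2ε')·rstar`. If `S ⊆ T` is an
independent set whose coreset cost `rS` satisfies `rS ≤ α · (coreset cost of Y)` for
every independent `Y ⊆ T`, then there exists `W ⊆ V` with `|W| ≥ |V| − z` and
`d(j, S) ≤ (α + ε)·rstar` for every `j ∈ W`. -/
theorem approx_on_coreset_gives_approx_on_V {P : Type*} [MetricSpace P] [DecidableEq P]
    (V : Finset P) (I : Finset P → Prop)
    (hground : ∀ A : Finset P, I A → A ⊆ V)
    (hempty : I ∅)
    (hhered : ∀ A B : Finset P, B ⊆ A → I A → I B)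
    (haug : ∀ A B : Finset P, I A → I B → B.card < A.card →
      ∃ x ∈ A \ B, I (insert x B))
    (z : ℕ) (ε α : ℝ) (hε : ε ∈ Set.Ioo (0 : ℝ) 1) (hα : 1 ≤ α)
    (rstar : ℝ) (hrstar : 0 ≤ rstar)
    (T : Finset P) (hT : T ⊆ V)
    (p : P → P) (hp : ∀ j ∈ V, p j ∈ T)
    (hC1 : ∀ j ∈ V, dist j (p j) ≤ (ε / (2 * α + 1)) * rstar)
    -- (P1): some independent `Y₀ ⊆ T` has coreset cost at most `(1 + 2ε')·rstar`
    (hP1 : ∃ Y₀ X₀ : Finset P, Y₀ ⊆ T ∧ I Y₀ ∧ X₀ ⊆ T ∧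
      V.card - z ≤ ∑ i ∈ X₀, (V.filter (fun j => p j = i)).card ∧
      ∀ i ∈ X₀, ∃ c ∈ Y₀, dist i c ≤ (1 + 2 * (ε / (2 * α + 1))) * rstar)
    (S : Finset P) (hS : S ⊆ T) (hSind : I S)
    (rS : ℝ)
    -- `rS` is a feasible coreset cost for `S`
    (hrS : ∃ X : Finset P, X ⊆ T ∧
      V.card - z ≤ ∑ i ∈ X, (V.filter (fun j => p j = i)).card ∧
      ∀ i ∈ X, ∃ c ∈ S, dist i c ≤ rS)
    -- `S` is `α`-approximate: `rS ≤ α ·` (any feasible coreset cost of any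
    -- independent `Y ⊆ T`), hence `rS ≤ α ·` (the least such cost)
    (happx : ∀ Y : Finset P, Y ⊆ T → I Y → ∀ rY : ℝ,
      (∃ X : Finset P, X ⊆ T ∧
        V.card - z ≤ ∑ i ∈ X, (V.filter (fun j => p j = i)).card ∧
        ∀ i ∈ X, ∃ c ∈ Y, dist i c ≤ rY) → rS ≤ α * rY) :
    ∃ W : Finset P, W ⊆ V ∧ V.card - z ≤ W.card ∧
      ∀ j ∈ W, ∃ c ∈ S, dist j c ≤ (α + ε) * rstar := by
  obtain ⟨Y₀, X₀, hY₀T, hY₀, hX₀⟩ := hP1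
  have hrS_le := happx Y₀ hY₀T hY₀ _ ⟨X₀, hX₀⟩
  obtain ⟨X, -, hXcard, hX⟩ := hrS
  have hε' : ε / (2 * α + 1) * (2 * α + 1) = ε := div_mul_cancel₀ _ (by linarith)
  refine ⟨V.filter (fun j => p j ∈ X), Finset.filter_subset _ _, ?_, ?_⟩
  · rwa [← Finset.sum_card_fiberwise_eq_card_filter]
  · intro j hj
    obtain ⟨hjV, hjX⟩ := Finset.mem_filter.mp hj
    obtain ⟨c, hcS, hc⟩ := hX _ hjX
    refine ⟨c, hcS, ?_⟩
    calc dist j c ≤ dist j (p j) + dist (p j) c := dist_triangle _ _ _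
      _ ≤ ε / (2 * α + 1) * rstar + α * ((1 + 2 * (ε / (2 * α + 1))) * rstar) :=
        add_le_add (hC1 j hjV) (hc.trans hrS_le)
      _ = (α + ε / (2 * α + 1) * (2 * α + 1)) * rstar := by ring
      _ = (α + ε) * rstar := by rw [hε']
end

section
/- Let V be a finite set of points in a metric space, w : V → [0,1] a weight function, z a nonnegative integer, and r₁, r₂ ≥ 0. Let C₁, …, C_τ be a partition of V such that any two points lying in the same cluster C_ℓ are at distance at most 2r₁ from each other. For each ℓ, let i_ℓ ∈ C_ℓ, set T = {i₁, …, i_τ}, and let m_{i_ℓ} = |C_ℓ|. Suppose S ⊆ T satisfies Σ_{s ∈ S} w_s ≤ 1 and there exists X ⊆ T with Σ_{i ∈ X} m_i ≥ |V| − z and d(i, S) ≤ r₂ for every i ∈ X. Then S is a feasible solution to the robust knapsack center instance (V, z, w) of cost at most 2r₁ + r₂: Σ_{s ∈ S} w_s ≤ 1 and there exists W ⊆ V with |W| ≥ |V| − z and d(j, S) ≤ 2r₁ + r₂ for every j ∈ W. -/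
/-- **Lemma 8, Point 1.**
Let `V` be a finite set in a metric space, `w : V → [0,1]` weights, `z ≥ 0`,
`r₁, r₂ ≥ 0`. Let `C₁, …, C_τ` partition `V` with any two points of the same cluster
at distance at most `2r₁`. For each `ℓ` pick `i ℓ ∈ C ℓ`, set `T = {i₁, …, i_τ}` and
give `i ℓ` multiplicity `|C ℓ|`. If `S ⊆ T` satisfies `Σ_{s ∈ S} w s ≤ 1` and there
is `X ⊆ T` with `Σ_{x ∈ X} m x ≥ |V| − z` and `d(x, S) ≤ r₂` for every `x ∈ X`, then
`S` is feasible for the robust knapsack center instance `(V, z, w)` with cost at most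
`2r₁ + r₂`: `Σ_{s ∈ S} w s ≤ 1` and there is `W ⊆ V` with `|W| ≥ |V| − z` and
`d(j, S) ≤ 2r₁ + r₂` for every `j ∈ W`. -/
theorem rkc_coreset_solution_feasible {P : Type*} [MetricSpace P] [DecidableEq P]
    (V : Finset P) (w : P → ℝ) (hw : ∀ j ∈ V, w j ∈ Set.Icc (0 : ℝ) 1)
    (z : ℕ) (r₁ r₂ : ℝ) (hr₁ : 0 ≤ r₁) (hr₂ : 0 ≤ r₂)
    (τ : ℕ) (C : Fin τ → Finset P)
    (hdisj : ∀ ℓ ℓ' : Fin τ, ℓ ≠ ℓ' → Disjoint (C ℓ) (C ℓ'))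
    (hcover : Finset.univ.biUnion C = V)
    (hdiam : ∀ ℓ : Fin τ, ∀ p ∈ C ℓ, ∀ q ∈ C ℓ, dist p q ≤ 2 * r₁)
    (i : Fin τ → P) (hi : ∀ ℓ, i ℓ ∈ C ℓ)
    (S : Finset P) (hS : S ⊆ Finset.univ.image i)
    (hSw : ∑ s ∈ S, w s ≤ 1)
    (X : Finset P) (hX : X ⊆ Finset.univ.image i)
    (hXm : V.card - z ≤
      ∑ x ∈ X, ∑ ℓ ∈ Finset.univ.filter (fun ℓ => i ℓ = x), (C ℓ).card)
    (hXcov : ∀ x ∈ X, ∃ c ∈ S, dist x c ≤ r₂) :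
    (∑ s ∈ S, w s ≤ 1) ∧
    ∃ W : Finset P, W ⊆ V ∧ V.card - z ≤ W.card ∧
      ∀ j ∈ W, ∃ c ∈ S, dist j c ≤ 2 * r₁ + r₂ := by
  refine ⟨hSw, (Finset.univ.filter (fun ℓ => i ℓ ∈ X)).biUnion C, ?_, ?_, ?_⟩
  · rw [← hcover]
    exact Finset.biUnion_subset_biUnion_of_subset_left C (Finset.filter_subset _ _)
  · rwa [Finset.card_biUnion fun ℓ _ ℓ' _ h => hdisj ℓ ℓ' h,
      ← Finset.sum_fiberwise_eq_sum_filter]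
  · intro j hj
    simp only [Finset.mem_biUnion, Finset.mem_filter, Finset.mem_univ, true_and] at hj
    obtain ⟨ℓ, hℓ, hjℓ⟩ := hj
    obtain ⟨c, hc, hdist⟩ := hXcov (i ℓ) hℓ
    exact ⟨c, hc, (dist_triangle j (i ℓ) c).trans
      (add_le_add (hdiam ℓ j hjℓ (i ℓ) (hi ℓ)) hdist)⟩
end

section
/- Let V be a finite set of points in a metric space, w : V → [0,1] a weight function, z a nonnegative integer, and r₁, r* ≥ 0. Let C₁, …, C_τ be a partition of V such that any two points lying in the same cluster C_ℓ are at distance at most 2r₁ from each other. For each ℓ, let i_ℓ be a point of minimum weight in C_ℓ (w_{i_ℓ} ≤ w_j for all j ∈ C_ℓ), set T = {i₁, …, i_τ}, and let m_{i_ℓ} = |C_ℓ|. Suppose S* ⊆ V satisfies Σ_{j ∈ S*} w_j ≤ 1 and there exists W* ⊆ V with |W*| ≥ |V| − z and d(j, S*) ≤ r* for every j ∈ W*. Then there exists X ⊆ T with Σ_{i ∈ X} w_i ≤ 1 and a set Z ⊆ T with Σ_{i ∈ Z} m_i ≥ |V| − z such that d(i, X) ≤ r* + 4r₁ for every i ∈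 Z. -/
/-- **Lemma 8, Point 2 (existence of a good solution in the RKC coreset).**
Let `V` be a finite set in a metric space, `w : V → [0,1]` weights, `z ≥ 0`,
`r₁, rstar ≥ 0`. Let `C₁, …, C_τ` partition `V` with any two points of the same
cluster at distance at most `2r₁`. For each `ℓ` let `i ℓ` be a point of minimum
weight in `C ℓ`, set `T = {i₁, …, i_τ}` and give `i ℓ` multiplicity `|C ℓ|`. If
`Sstar ⊆ V` satisfies `Σ_{j ∈ Sstar} w j ≤ 1` and there is `Wstar ⊆ V` with
`|Wstar| ≥ |V| − z` and `d(j, Sstar) ≤ rstar` for every `j ∈ Wstar`, then there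
exist `X ⊆ T` with `Σ_{x ∈ X} w x ≤ 1` and `Z ⊆ T` with
`Σ_{x ∈ Z} m x ≥ |V| − z` such that `d(x, X) ≤ rstar + 4r₁` for every `x ∈ Z`. -/
theorem rkc_coreset_contains_good_solution {P : Type*} [MetricSpace P] [DecidableEq P]
    (V : Finset P) (w : P → ℝ) (hw : ∀ j ∈ V, w j ∈ Set.Icc (0 : ℝ) 1)
    (z : ℕ) (r₁ rstar : ℝ) (hr₁ : 0 ≤ r₁) (hrstar : 0 ≤ rstar)
    (τ : ℕ) (C : Fin τ → Finset P)
    (hdisj : ∀ ℓ ℓ' : Fin τ, ℓ ≠ ℓ' → Disjoint (C ℓ) (C ℓ'))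
    (hcover : Finset.univ.biUnion C = V)
    (hdiam : ∀ ℓ : Fin τ, ∀ p ∈ C ℓ, ∀ q ∈ C ℓ, dist p q ≤ 2 * r₁)
    (i : Fin τ → P) (hi : ∀ ℓ, i ℓ ∈ C ℓ)
    (himin : ∀ ℓ : Fin τ, ∀ j ∈ C ℓ, w (i ℓ) ≤ w j)
    (Sstar : Finset P) (hSstar : Sstar ⊆ V)
    (hSw : ∑ j ∈ Sstar, w j ≤ 1)
    (Wstar : Finset P) (hWstar : Wstar ⊆ V) (hWcard : V.card - z ≤ Wstar.card)
    (hWcov : ∀ j ∈ Wstar, ∃ c ∈ Sstar, dist j c ≤ rstar) :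
    ∃ X Z : Finset P, X ⊆ Finset.univ.image i ∧ Z ⊆ Finset.univ.image i ∧
      (∑ x ∈ X, w x ≤ 1) ∧
      V.card - z ≤
        ∑ x ∈ Z, ∑ ℓ ∈ Finset.univ.filter (fun ℓ => i ℓ = x), (C ℓ).card ∧
      ∀ x ∈ Z, ∃ c ∈ X, dist x c ≤ rstar + 4 * r₁ := by
  classical
  have mem_cluster : ∀ p ∈ V, ∃ ℓ, p ∈ C ℓ := by
    intro p hp
    simpa [← hcover] using hp
  have cluster_unique : ∀ ℓ ℓ' p, p ∈ C ℓ → p ∈ C ℓ' → ℓ = ℓ' := by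
    intro ℓ ℓ' p hp hp'
    by_contra hne
    exact Finset.disjoint_left.mp (hdisj ℓ ℓ' hne) hp hp'
  have i_inj : Function.Injective i := fun ℓ ℓ' h =>
    cluster_unique ℓ ℓ' (i ℓ) (hi ℓ) (h ▸ hi ℓ')
  let L : Finset (Fin τ) := Finset.univ.filter fun ℓ => ∃ p ∈ Sstar, p ∈ C ℓ
  let M : Finset (Fin τ) := Finset.univ.filter fun ℓ => ∃ p ∈ Wstar, p ∈ C ℓ
  refine ⟨L.image i, M.image i, Finset.image_subset_image (Finset.subset_univ _),
    Finset.image_subset_image (Finset.subset_univ _), ?_, ?_, ?_⟩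
  · have hL : ∀ ℓ, ∃ p, ℓ ∈ L → p ∈ Sstar ∧ p ∈ C ℓ := by
      intro ℓ
      by_cases h : ℓ ∈ L
      · obtain ⟨p, hp⟩ := (Finset.mem_filter.mp h).2
        exact ⟨p, fun _ => hp⟩
      · exact ⟨i ℓ, fun h' => absurd h' h⟩
    choose s hs using hL
    have s_inj : Set.InjOn s L := fun ℓ hℓ ℓ' hℓ' h =>
      cluster_unique ℓ ℓ' (s ℓ) (hs ℓ hℓ).2 (h ▸ (hs ℓ' hℓ').2)
    calc ∑ x ∈ L.image i, w x = ∑ ℓ ∈ L, w (i ℓ) := Finset.sum_image i_inj.injOn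
      _ ≤ ∑ ℓ ∈ L, w (s ℓ) :=
        Finset.sum_le_sum fun ℓ hℓ => himin ℓ (s ℓ) (hs ℓ hℓ).2
      _ = ∑ x ∈ L.image s, w x := (Finset.sum_image s_inj).symm
      _ ≤ ∑ x ∈ Sstar, w x :=
        Finset.sum_le_sum_of_subset_of_nonneg
          (Finset.image_subset_iff.mpr fun ℓ hℓ => (hs ℓ hℓ).1)
          fun x hx _ => (hw x (hSstar hx)).1
      _ ≤ 1 := hSw
  · have hsub : Wstar ⊆ M.biUnion C := by
      intro p hp
      obtain ⟨ℓ, hℓ⟩ := mem_cluster p (hWstar hp)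
      exact Finset.mem_biUnion.mpr ⟨ℓ, Finset.mem_filter.mpr ⟨Finset.mem_univ _, p, hp, hℓ⟩, hℓ⟩
    rw [Finset.sum_image i_inj.injOn]
    calc V.card - z ≤ Wstar.card := hWcard
      _ ≤ (M.biUnion C).card := Finset.card_le_card hsub
      _ ≤ ∑ ℓ ∈ M, (C ℓ).card := Finset.card_biUnion_le
      _ ≤ ∑ ℓ ∈ M, ∑ ℓ' ∈ Finset.univ.filter (fun ℓ' => i ℓ' = i ℓ), (C ℓ').card :=
        Finset.sum_le_sum fun ℓ _ =>
        Finset.single_le_sum (f := fun ℓ' => (C ℓ').card) (fun _ _ => Nat.zero_le _)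
          (Finset.mem_filter.mpr ⟨Finset.mem_univ ℓ, rfl⟩)
  · intro x hx
    obtain ⟨ℓ, hℓ, rfl⟩ := Finset.mem_image.mp hx
    obtain ⟨p, hpW, hpC⟩ := (Finset.mem_filter.mp hℓ).2
    obtain ⟨c, hcS, hpc⟩ := hWcov p hpW
    obtain ⟨ℓ', hcC⟩ := mem_cluster c (hSstar hcS)
    refine ⟨i ℓ', Finset.mem_image_of_mem i
      (Finset.mem_filter.mpr ⟨Finset.mem_univ _, c, hcS, hcC⟩), ?_⟩
    linarith [dist_triangle4 (i ℓ) p c (i ℓ'), hdiam ℓ (i ℓ) (hi ℓ) p hpC,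
      hdiam ℓ' c hcC (i ℓ') (hi ℓ')]
end
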